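/- Let d ≥ 2, let Ω ⊆ ℝ^d be an open, bounded, nonempty set, and let ε > 0. Then there exist α ∈ (0,1] and g ∈ L^∞_α such that λ₁^g(Ω) ≤ λ₁(Ω) + ε. -/

import Mathlib

open MeasureTheory Metric Set Filter

open scoped Classical ENNReal

noncomputable section

/-- The Rayleigh quotient of `u : ℝ^d → ℝ`. -/
def rayleigh (d : ℕ) (u : EuclideanSpace ℝ (Fin d) → ℝ) : ℝ :=
  (∫ x, ‖gradient u x‖ ^ 2) / (∫ x, (u x) ^ 2)

/-- A trial function for the Dirichlet eigenvalue on `Ω`: Lipschitz, vanishing outside `Ω`,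
and not almost everywhere zero. -/
def IsDirTrial (d : ℕ) (Ω : Set (EuclideanSpace ℝ (Fin d)))
    (u : EuclideanSpace ℝ (Fin d) → ℝ) : Prop :=
  (∃ K, LipschitzWith K u) ∧ (∀ x ∉ Ω, u x = 0) ∧ ¬ (u =ᵐ[volume] fun _ => (0 : ℝ))

/-- The first Dirichlet eigenvalue of `Ω`. -/
def dirichletEV (d : ℕ) (Ω : Set (EuclideanSpace ℝ (Fin d))) : ℝ :=
  sInf { r | ∃ u, IsDirTrial d Ω u ∧ rayleigh d u = r }

/-- The first twisted eigenvalue of `Ω` with orthogonality constraint `g`. -/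
def twistedEV (d : ℕ) (Ω : Set (EuclideanSpace ℝ (Fin d)))
    (g : EuclideanSpace ℝ (Fin d) → ℝ) : ℝ :=
  sInf { r | ∃ u, IsDirTrial d Ω u ∧ (∫ x, u x * g x) = 0 ∧ rayleigh d u = r }

/-- `u` is a minimizer for the first twisted eigenvalue `λ₁^g(Ω)`. -/
def IsTwistedMin (d : ℕ) (Ω : Set (EuclideanSpace ℝ (Fin d)))
    (g u : EuclideanSpace ℝ (Fin d) → ℝ) : Prop :=
  IsDirTrial d Ω u ∧ (∫ x, u x * g x) = 0 ∧ rayleigh d u = twistedEV d Ω g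

/-- The bang-bang function equal to `1` on `Bm` and `α` elsewhere. -/
def chiBang (d : ℕ) (α : ℝ) (Bm : Set (EuclideanSpace ℝ (Fin d))) :
    EuclideanSpace ℝ (Fin d) → ℝ :=
  fun x => if x ∈ Bm then 1 else α

lemma norm_fderiv_le_of_abs_sub_le {E : Type*} [NormedAddCommGroup E] [NormedSpace ℝ E]
    {u v : E → ℝ} {x : E} (hu : DifferentiableAt ℝ u x) (hv : DifferentiableAt ℝ v x)
    (h : ∀ y, |v y - v x| ≤ |u y - u x|) : ‖fderiv ℝ v x‖ ≤ ‖fderiv ℝ u x‖ := by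
  refine le_of_forall_pos_le_add fun η hη => ?_
  refine hv.hasFDerivAt.le_of_lip' (by positivity) ?_
  filter_upwards [hu.hasFDerivAt.isLittleO.def hη] with y hy
  calc ‖v y - v x‖ ≤ ‖u y - u x‖ := h y
    _ = ‖(u y - u x - fderiv ℝ u x (y - x)) + fderiv ℝ u x (y - x)‖ := by rw [sub_add_cancel]
    _ ≤ η * ‖y - x‖ + ‖fderiv ℝ u x‖ * ‖y - x‖ :=
      (norm_add_le _ _).trans (add_le_add hy ((fderiv ℝ u x).le_opNorm _))
    _ = (‖fderiv ℝ u x‖ + η) * ‖y - x‖ := by ring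

lemma norm_gradient_eq {E : Type*} [NormedAddCommGroup E] [InnerProductSpace ℝ E]
    [CompleteSpace E] (u : E → ℝ) (x : E) : ‖gradient u x‖ = ‖fderiv ℝ u x‖ := by
  simp [gradient]

lemma rayleigh_nonneg (d : ℕ) (u : EuclideanSpace ℝ (Fin d) → ℝ) : 0 ≤ rayleigh d u :=
  div_nonneg (integral_nonneg fun _ => by positivity) (integral_nonneg fun _ => by positivity)

lemma hasCompactSupport_of_zero_outside {d : ℕ} {Ω : Set (EuclideanSpace ℝ (Fin d))}
    (hΩb : Bornology.IsBounded Ω) {u : EuclideanSpace ℝ (Fin d) → ℝ}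
    (hu : ∀ x ∉ Ω, u x = 0) : HasCompactSupport u :=
  HasCompactSupport.of_support_subset_isCompact hΩb.isCompact_closure fun x hx =>
    subset_closure (by by_contra h; exact hx (hu x h))

lemma integrable_norm_gradient_sq {d : ℕ} {u : EuclideanSpace ℝ (Fin d) → ℝ} {K : NNReal}
    (hK : LipschitzWith K u) (hc : HasCompactSupport u) :
    Integrable fun x => ‖gradient u x‖ ^ 2 := by
  simp_rw [norm_gradient_eq]
  have hs : Function.support (fun x => ‖fderiv ℝ u x‖ ^ 2) ⊆ tsupport u := fun x hx => by
    refine support_fderiv_subset ℝ (f := u) (fun h => hx ?_)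
    simp [h]
  refine (integrableOn_iff_integrable_of_support_subset hs).1 ?_
  refine Measure.integrableOn_of_bounded (M := (K : ℝ) ^ 2) hc.isCompact.measure_lt_top.ne ?_ ?_
  · exact ((measurable_fderiv ℝ u).norm.pow_const 2).aestronglyMeasurable
  · refine ae_of_all _ fun x => ?_
    rw [Real.norm_of_nonneg (by positivity)]
    gcongr
    exact norm_fderiv_le_of_lipschitz ℝ hK

/-- A trial function taking both signs is orthogonal to some admissible weight. -/
lemma exists_orthogonal_weight {d : ℕ} {v : EuclideanSpace ℝ (Fin d) → ℝ}
    (hv : Continuous v) (hc : HasCompactSupport v) {p q : EuclideanSpace ℝ (Fin d)}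
    (hp : 0 < v p) (hq : v q < 0) :
    ∃ (α : ℝ) (g : EuclideanSpace ℝ (Fin d) → ℝ), 0 < α ∧ α ≤ 1 ∧ Measurable g ∧
      (∀ x, α ≤ g x ∧ g x ≤ 1) ∧ ∫ x, v x * g x = 0 := by
  have hcp : HasCompactSupport fun x => max (v x) 0 :=
    hc.comp_left (g := fun t => max t 0) (by simp)
  have hcn : HasCompactSupport fun x => max (-v x) 0 :=
    hc.comp_left (g := fun t => max (-t) 0) (by simp)
  have hvp : Continuous fun x => max (v x) 0 := by fun_prop
  have hvn : Continuous fun x => max (-v x) 0 := by fun_prop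
  have hP : 0 < ∫ x, max (v x) 0 :=
    hvp.integral_pos_of_hasCompactSupport_nonneg_nonzero hcp (fun x => le_max_right _ _)
      (x := p) (lt_max_of_lt_left hp).ne'
  have hN : 0 < ∫ x, max (-v x) 0 :=
    hvn.integral_pos_of_hasCompactSupport_nonneg_nonzero hcn (fun x => le_max_right _ _)
      (x := q) (lt_max_of_lt_left (neg_pos.2 hq)).ne'
  have hiP := hvp.integrable_of_hasCompactSupport (μ := volume) hcp
  have hiN := hvn.integrable_of_hasCompactSupport (μ := volume) hcn
  set P := ∫ x, max (v x) 0
  set N := ∫ x, max (-v x) 0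
  have hM : 0 < max P N := lt_max_of_lt_left hP
  refine ⟨min P N / max P N, fun x => if 0 < v x then N / max P N else P / max P N,
    div_pos (lt_min hP hN) hM, div_le_one_of_le₀ min_le_max hM.le,
    Measurable.ite (measurableSet_lt measurable_const hv.measurable) measurable_const
      measurable_const, fun x => ?_, ?_⟩
  · dsimp only
    split_ifs
    · exact ⟨by gcongr; exact min_le_right _ _, div_le_one_of_le₀ (le_max_right _ _) hM.le⟩
    · exact ⟨by gcongr; exact min_le_left _ _, div_le_one_of_le₀ (le_max_left _ _) hM.le⟩
  · have : (fun x => v x * if 0 < v x then N / max P N else P / max P N) = fun x =>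
        N / max P N * max (v x) 0 - P / max P N * max (-v x) 0 := by
      funext x
      split_ifs with h
      · rw [max_eq_left h.le, max_eq_right (neg_nonpos.2 h.le)]; ring
      · rw [max_eq_right (not_lt.1 h), max_eq_left (neg_nonneg.2 (not_lt.1 h))]; ring
    rw [this, integral_sub (hiP.const_mul _) (hiN.const_mul _), integral_const_mul,
      integral_const_mul]
    change N / max P N * P - P / max P N * N = 0
    ring

lemma abs_abs_sub_sub_le (t δ : ℝ) (hδ : 0 ≤ δ) : |(|t - δ| - δ)| ≤ |t| := by
  have := abs_abs_sub_abs_le_abs_sub (t - δ) (-δ)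
  rwa [abs_neg, abs_of_nonneg hδ, sub_neg_eq_add, sub_add_cancel] at this

/-- Replacing a trial function `w` by `|w - δ| - δ` for small `δ` produces a trial function of
both signs whose Rayleigh quotient is almost as small. -/
lemma exists_sign_changing_trial {d : ℕ} (hd : 2 ≤ d) {Ω : Set (EuclideanSpace ℝ (Fin d))}
    (hΩb : Bornology.IsBounded Ω) {u : EuclideanSpace ℝ (Fin d) → ℝ} (hu : IsDirTrial d Ω u)
    {r : ℝ} (hr : rayleigh d u < r) :
    ∃ v, IsDirTrial d Ω v ∧ rayleigh d v ≤ r ∧ (∃ p, 0 < v p) ∧ ∃ q, v q < 0 := by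
  obtain ⟨⟨K, hK⟩, h0, hne⟩ := hu
  have hc := hasCompactSupport_of_zero_outside hΩb h0
  obtain ⟨p, hp⟩ : ∃ p, u p ≠ 0 := by
    by_contra! h
    exact hne (ae_of_all _ h)
  obtain ⟨q, hq⟩ : ∃ q, q ∉ Ω := by
    by_contra! h
    have : Nonempty (Fin d) := ⟨⟨0, by omega⟩⟩
    exact NormedSpace.unbounded_univ ℝ (EuclideanSpace ℝ (Fin d))
      (hΩb.subset fun x _ => h x)
  obtain ⟨w, hwp, hwK, hwabs, hwsub⟩ : ∃ w : EuclideanSpace ℝ (Fin d) → ℝ, 0 < w p ∧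
      LipschitzWith K w ∧ (∀ x, |w x| = |u x|) ∧ ∀ x y, |w y - w x| = |u y - u x| := by
    rcases hp.lt_or_gt with h | h
    · exact ⟨fun x => -u x, by simpa using h, hK.neg, fun x => abs_neg _, fun x y => by
        rw [neg_sub_neg, abs_sub_comm]⟩
    · exact ⟨u, h, hK, fun _ => rfl, fun _ _ => rfl⟩
  have hw0 : ∀ x ∉ Ω, w x = 0 := fun x hx => by simpa [h0 x hx] using hwabs x
  have hwsq : ∀ x, w x ^ 2 = u x ^ 2 := fun x => sq_eq_sq_iff_abs_eq_abs _ _ |>.2 (hwabs x)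
  have hcu2 : HasCompactSupport fun x => u x ^ 2 := hc.comp_left (g := fun t => t ^ 2) (by simp)
  have hu2 : Continuous fun x => u x ^ 2 := hK.continuous.pow 2
  have hB : 0 < ∫ x, u x ^ 2 :=
    hu2.integral_pos_of_hasCompactSupport_nonneg_nonzero hcu2 (fun x => sq_nonneg _)
      (x := p) (pow_ne_zero 2 hp)
  have hlim : Tendsto (fun δ : ℝ => ∫ x, (|w x - δ| - δ) ^ 2) (nhdsWithin 0 (Ioi 0))
      (nhds (∫ x, u x ^ 2)) := by
    refine tendsto_integral_filter_of_dominated_convergence (fun x => u x ^ 2) ?_ ?_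
      (hu2.integrable_of_hasCompactSupport hcu2) ?_
    · have := hwK.continuous
      exact Eventually.of_forall fun δ => by
        apply Continuous.aestronglyMeasurable; fun_prop
    · filter_upwards [self_mem_nhdsWithin] with δ hδ
      refine ae_of_all _ fun x => ?_
      rw [Real.norm_of_nonneg (sq_nonneg _), ← hwsq]
      exact sq_le_sq.2 (abs_abs_sub_sub_le _ _ (le_of_lt hδ))
    · refine ae_of_all _ fun x => ?_
      have : Tendsto (fun δ : ℝ => (|w x - δ| - δ) ^ 2) (nhds 0) (nhds ((|w x - 0| - 0) ^ 2)) :=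
        Continuous.tendsto (by fun_prop) 0
      simp only [sub_zero, sq_abs, hwsq] at this
      exact this.mono_left nhdsWithin_le_nhds
  have hquot := (tendsto_const_nhds (x := ∫ x, ‖gradient u x‖ ^ 2)).div hlim hB.ne'
  have hsmall : ∀ᶠ δ : ℝ in nhdsWithin 0 (Ioi 0), δ < w p / 2 :=
    nhdsWithin_le_nhds (gt_mem_nhds (by positivity))
  obtain ⟨δ, hδr, hδB, hδp, hδ⟩ := ((hquot.eventually_lt_const hr).and
    ((hlim.eventually_const_lt hB).and (hsmall.and self_mem_nhdsWithin))).exists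
  replace hδ : 0 < δ := hδ
  obtain ⟨z, hz⟩ : ∃ z, w z = δ :=
    mem_range_of_exists_le_of_exists_ge hwK.continuous ⟨q, by rw [hw0 q hq]; exact hδ.le⟩
      ⟨p, by linarith⟩
  have hvsub : ∀ x y, |(|w y - δ| - δ) - (|w x - δ| - δ)| ≤ |u y - u x| := fun x y => by
    have := abs_abs_sub_abs_le_abs_sub (w y - δ) (w x - δ)
    rw [sub_sub_sub_cancel_right] at this ⊢
    exact this.trans (hwsub x y).le
  have hvK : LipschitzWith K fun x => |w x - δ| - δ :=
    LipschitzWith.of_dist_le_mul fun x y => by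
      rw [Real.dist_eq]
      exact (hvsub y x).trans (by simpa [Real.dist_eq] using hK.dist_le_mul x y)
  refine ⟨fun x => |w x - δ| - δ, ⟨⟨K, hvK⟩, fun x hx => ?_, fun h => ?_⟩, ?_, ⟨p, ?_⟩, z, ?_⟩
  · simp [hw0 x hx, abs_of_pos hδ]
  · refine hδB.ne' ?_
    rw [integral_eq_zero_of_ae]
    filter_upwards [h] with x hx
    simp [hx]
  · refine le_trans ?_ hδr.le
    refine div_le_div_of_nonneg_right ?_ hδB.le
    refine integral_mono_of_nonneg (ae_of_all _ fun x => by positivity)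
      (integrable_norm_gradient_sq hK hc) ?_
    filter_upwards [hK.ae_differentiableAt, hvK.ae_differentiableAt] with x hx hvx
    rw [norm_gradient_eq, norm_gradient_eq]
    gcongr
    exact norm_fderiv_le_of_abs_sub_le hx hvx fun y => hvsub x y
  · have := le_abs_self (w p - δ)
    dsimp only
    linarith
  · simpa [hz] using hδ

/-- for every `ε > 0` there are `α ∈ (0,1]` and `g ∈ L^∞_α` with
`λ₁^g(Ω) ≤ λ₁(Ω) + ε`. -/
theorem stmt4 (d : ℕ) (hd : 2 ≤ d) (Ω : Set (EuclideanSpace ℝ (Fin d)))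
    (hΩo : IsOpen Ω) (hΩb : Bornology.IsBounded Ω) (hΩn : Ω.Nonempty)
    (ε : ℝ) (hε : 0 < ε) :
    ∃ (α : ℝ) (g : EuclideanSpace ℝ (Fin d) → ℝ), 0 < α ∧ α ≤ 1 ∧ Measurable g ∧
      (∀ᵐ x, α ≤ g x ∧ g x ≤ 1) ∧ twistedEV d Ω g ≤ dirichletEV d Ω + ε := by
  rcases Set.eq_empty_or_nonempty { r | ∃ u, IsDirTrial d Ω u ∧ rayleigh d u = r } with he | hn
  · refine ⟨1, fun _ => 1, one_pos, le_rfl, measurable_const, by simp, ?_⟩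
    have he' : { r | ∃ u, IsDirTrial d Ω u ∧ (∫ x, u x * (1 : ℝ)) = 0 ∧ rayleigh d u = r } = ∅ :=
      Set.eq_empty_of_subset_empty fun r ⟨u, hu, _, hr⟩ => he ▸ ⟨u, hu, hr⟩
    rw [twistedEV, dirichletEV, he, he']
    linarith
  obtain ⟨_, ⟨u, hu, rfl⟩, hur⟩ := exists_lt_of_csInf_lt hn
    (show sInf _ < dirichletEV d Ω + ε from lt_add_of_pos_right _ hε)
  obtain ⟨v, hv, hvr, ⟨p, hp⟩, q, hq⟩ := exists_sign_changing_trial hd hΩb hu hur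
  obtain ⟨K, hK⟩ := hv.1
  obtain ⟨α, g, hα, hα1, hg, hgα, hvg⟩ := exists_orthogonal_weight hK.continuous
    (hasCompactSupport_of_zero_outside hΩb hv.2.1) hp hq
  refine ⟨α, g, hα, hα1, hg, ae_of_all _ hgα, le_trans (csInf_le ⟨0, ?_⟩ ⟨v, hv, hvg, rfl⟩) hvr⟩
  rintro _ ⟨w, _, _, rfl⟩
  exact rayleigh_nonneg d w
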